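/- arXiv:1709.04906 — 3 statements merged into one kernel-verified Lean document; each statement's English description precedes it below -/
import Mathlib

section
/- Let (V,E) be a finite directed acyclic graph and let f : E → ℝ be a nonnegative flow that conserves (a, b), where the injection a : V → ℝ≥0 and the extraction b : V → ℝ≥0 have disjoint supports. Then there exist finitely many directed paths p₁, …, p_k in (V,E) and weights w₁, …, w_k > 0, with k ≤ |E| + |V|, such that: (i) f(e) = Σ_{i : e ∈ p_i} w_i for every e ∈ E (i.e., f = Σᵢ wᵢ·1_{pᵢ}); (ii) each path pᵢ starts at a vertex in the support of a and ends at a vertex in the support of b; (iii) for every v ∈ V, the total weight of the paths starting at v equals a(v) and the total weight of the paths ending at v equals b(v). -/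
open Finset

/-- Inflow of a flow `f` at vertex `v`, over the edge set `E`. -/
def inflow {V : Type*} [DecidableEq V] (E : Finset (V × V)) (f : V × V → ℝ) (v : V) : ℝ :=
  ∑ e ∈ E.filter (fun e => e.2 = v), f e

/-- Outflow of a flow `f` at vertex `v`, over the edge set `E`. -/
def outflow {V : Type*} [DecidableEq V] (E : Finset (V × V)) (f : V × V → ℝ) (v : V) : ℝ :=
  ∑ e ∈ E.filter (fun e => e.1 = v), f e

/-- `f` conserves the injection `a` and the extraction `b`:
`inflow(f,v) + a(v) = outflow(f,v) + b(v)` for every vertex `v`. -/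
def Conserves {V : Type*} [DecidableEq V] (E : Finset (V × V)) (f : V × V → ℝ)
    (a b : V → ℝ) : Prop :=
  ∀ v : V, inflow E f v + a v = outflow E f v + b v

/-- A directed path in `(V,E)`: a list of at least two distinct vertices,
with consecutive pairs being edges of `E`. -/
def IsDiPath {V : Type*} (E : Finset (V × V)) (p : List V) : Prop :=
  p.Nodup ∧ 2 ≤ p.length ∧ p.Chain' (fun u w => (u, w) ∈ E)

/-- Indicator of a path, as a function on edges: `1` on each edge traversed
by the path, `0` on every other edge. -/
def pathIndicator {V : Type*} [DecidableEq V] (p : List V) (e : V × V) : ℝ :=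
  if e ∈ p.zip p.tail then 1 else 0

theorem exists_reflTransGen_of_progress {α : Type*} [Finite α] {r : α → α → Prop}
    (hr : ∀ x, ¬ Relation.TransGen r x x) {P Q : α → Prop}
    (h : ∀ x, P x → Q x ∨ ∃ y, r x y ∧ P y) (x : α) (hx : P x) :
    ∃ y, Relation.ReflTransGen r x y ∧ Q y := by
  let s : α → α → Prop := fun x y => Relation.TransGen r y x
  have : IsTrans α s := ⟨fun _ _ _ h₁ h₂ => h₂.trans h₁⟩
  have : Std.Irrefl s := ⟨hr⟩
  have hwf : WellFounded s := Finite.wellFounded_of_trans_of_irrefl s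
  induction x using hwf.induction with
  | _ x ih =>
    rcases h x hx with hQ | ⟨y, hxy, hy⟩
    · exact ⟨x, .refl, hQ⟩
    · obtain ⟨z, hyz, hz⟩ := ih y (.single hxy) hy
      exact ⟨z, .head hxy hyz, hz⟩

theorem List.IsChain.nodup_of_acyclic {α : Type*} {r : α → α → Prop}
    (hr : ∀ x, ¬ Relation.TransGen r x x) {l : List α} (hl : l.IsChain r) : l.Nodup := by
  have h : l.IsChain (Relation.TransGen r) := hl.imp fun _ _ => .single
  refine (List.isChain_iff_pairwise.1 h).imp ?_
  rintro x _ hxy rfl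
  exact hr x hxy

theorem List.IsChain.of_mem_zip_tail {α : Type*} {r : α → α → Prop} {l : List α}
    (hl : l.IsChain r) {e : α × α} (he : e ∈ l.zip l.tail) : r e.1 e.2 := by
  induction hl with
  | nil => simp at he
  | singleton => simp at he
  | cons_cons hab _ ih =>
    rcases List.mem_cons.1 he with rfl | he
    · exact hab
    · exact ih he

section Flow

variable {V : Type*} [DecidableEq V]

theorem inflow_sub_mul (E : Finset (V × V)) (f g : V × V → ℝ) (c : ℝ) (v : V) :
    inflow E (fun e => f e - c * g e) v = inflow E f v - c * inflow E g v := by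
  simp [inflow, Finset.sum_sub_distrib, Finset.mul_sum]

theorem outflow_sub_mul (E : Finset (V × V)) (f g : V × V → ℝ) (c : ℝ) (v : V) :
    outflow E (fun e => f e - c * g e) v = outflow E f v - c * outflow E g v := by
  simp [outflow, Finset.sum_sub_distrib, Finset.mul_sum]

theorem pathIndicator_cons_cons {x y : V} {l : List V} (h : (x :: y :: l).Nodup) (e : V × V) :
    pathIndicator (x :: y :: l) e = (if e = (x, y) then 1 else 0) + pathIndicator (y :: l) e := by
  have hx : x ∉ y :: l := (List.nodup_cons.1 h).1
  have hnot : (x, y) ∉ (y :: l).zip l := fun hm => hx (List.of_mem_zip hm).1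
  by_cases he : e = (x, y)
  · subst he
    simp [pathIndicator, hnot]
  · simp only [pathIndicator, List.tail_cons, List.zip_cons_cons, List.mem_cons, he, false_or,
      if_false, zero_add]
    congr

theorem sum_filter_ite_eq {α : Type*} [DecidableEq α] {E : Finset α} {a : α} (ha : a ∈ E)
    (P : α → Prop) [DecidablePred P] :
    ∑ e ∈ E.filter P, (if e = a then (1 : ℝ) else 0) = if P a then 1 else 0 := by
  simp [Finset.sum_ite_eq', ha]

/-- A path carries one unit of flow from its first vertex to its last. -/
theorem conserves_pathIndicator (E : Finset (V × V)) (l : List V) (x : V)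
    (hn : (x :: l).Nodup) (hc : (x :: l).IsChain (fun u w => (u, w) ∈ E)) :
    Conserves E (pathIndicator (x :: l)) (fun v => if (x :: l).head? = some v then 1 else 0)
      (fun v => if (x :: l).getLast? = some v then 1 else 0) := by
  intro v
  induction l generalizing x with
  | nil => simp [inflow, outflow, pathIndicator]
  | cons y l ih =>
    obtain ⟨hxy, hc'⟩ := List.isChain_cons_cons.1 hc
    have := ih y (List.nodup_cons.1 hn).2 hc'
    have hlast : (x :: y :: l).getLast? = (y :: l).getLast? := by simp
    rw [hlast]
    simp only [inflow, outflow, pathIndicator_cons_cons hn, Finset.sum_add_distrib,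
      sum_filter_ite_eq hxy, List.head?_cons, Option.some.injEq] at this ⊢
    linarith

/-- A nonzero conserved flow on a DAG admits a path through edges carrying positive flow, from a
vertex with injection to a vertex with extraction. -/
theorem exists_positive_path [Finite V] (E : Finset (V × V))
    (hacyc : ∀ v : V, ¬ Relation.TransGen (fun u w => (u, w) ∈ E) v v)
    (f : V × V → ℝ) (hf : ∀ e ∈ E, 0 ≤ f e) (a b : V → ℝ) (ha : ∀ v, 0 ≤ a v)
    (hb : ∀ v, 0 ≤ b v) (hcons : Conserves E f a b) (hne : ∃ e ∈ E, f e ≠ 0) :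
    ∃ (x y : V) (l : List V) (z : V),
      (x :: y :: l).IsChain (fun u w => (u, w) ∈ E ∧ 0 < f (u, w)) ∧
      (x :: y :: l).getLast? = some z ∧ 0 < a x ∧ 0 < b z := by
  set r : V → V → Prop := fun u w => (u, w) ∈ E ∧ 0 < f (u, w) with hr
  have hacr : ∀ v, ¬ Relation.TransGen r v v := fun v hv =>
    hacyc v (Relation.TransGen.mono (fun _ _ h => h.1) _ _ hv)
  have hacs : ∀ v, ¬ Relation.TransGen (Function.swap r) v v := fun v hv =>
    hacr v (Relation.transGen_swap.1 hv)
  have in_pos : ∀ {u v}, r u v → 0 < inflow E f v := fun {u v} h =>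
    Finset.sum_pos' (fun e he => hf e (Finset.mem_filter.1 he).1) ⟨(u, v), by simp [h.1], h.2⟩
  have out_pos : ∀ {u v}, r u v → 0 < outflow E f u := fun {u v} h =>
    Finset.sum_pos' (fun e he => hf e (Finset.mem_filter.1 he).1) ⟨(u, v), by simp [h.1], h.2⟩
  have of_in : ∀ v, 0 < inflow E f v → ∃ u, r u v := by
    intro v hv
    obtain ⟨⟨u, w⟩, he, hpos⟩ := Finset.exists_lt_of_sum_lt
      (s := E.filter (fun e => e.2 = v)) (f := fun _ => (0 : ℝ)) (g := f)
      (by simpa [inflow] using hv)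
    obtain ⟨hE, rfl⟩ := Finset.mem_filter.1 he
    exact ⟨u, hE, hpos⟩
  have of_out : ∀ v, 0 < outflow E f v → ∃ u, r v u := by
    intro v hv
    obtain ⟨⟨u, w⟩, he, hpos⟩ := Finset.exists_lt_of_sum_lt
      (s := E.filter (fun e => e.1 = v)) (f := fun _ => (0 : ℝ)) (g := f)
      (by simpa [outflow] using hv)
    obtain ⟨hE, rfl⟩ := Finset.mem_filter.1 he
    exact ⟨w, hE, hpos⟩
  obtain ⟨⟨u, v⟩, he, hfe⟩ := hne
  have huv : r u v := ⟨he, (hf _ he).lt_of_ne' hfe⟩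
  obtain ⟨z, hvz, hz⟩ := exists_reflTransGen_of_progress hacr
    (P := fun v => 0 < inflow E f v) (Q := fun v => 0 < b v) (fun x hx => by
      rcases (hb x).lt_or_eq with h | h
      · exact .inl h
      · obtain ⟨y, hy⟩ := of_out x (by have := hcons x; have := ha x; linarith)
        exact .inr ⟨y, hy, in_pos hy⟩) v (in_pos huv)
  obtain ⟨x, hxu, hx⟩ := exists_reflTransGen_of_progress hacs
    (P := fun v => 0 < outflow E f v) (Q := fun v => 0 < a v) (fun x hx => by
      rcases (ha x).lt_or_eq with h | h
      · exact .inl h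
      · obtain ⟨y, hy⟩ := of_in x (by have := hcons x; have := hb x; linarith)
        exact .inr ⟨y, hy, out_pos hy⟩) u (out_pos huv)
  have hxz : Relation.TransGen r x z :=
    Relation.TransGen.trans_right (Relation.reflTransGen_swap.1 hxu) (.head' huv hvz)
  obtain ⟨y, hxy, hyz⟩ := Relation.TransGen.head'_iff.1 hxz
  obtain ⟨l, hl, hlast⟩ := List.exists_isChain_cons_of_relationReflTransGen hyz
  refine ⟨x, y, l, z, hl.cons_cons hxy, ?_, hx, hz⟩
  rw [List.getLast?_eq_getLast_of_ne_nil (List.cons_ne_nil _ _), List.getLast_cons_cons, hlast]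

/-- Flow decomposition, with the number of paths bounded by the sizes of the supports. -/
theorem exists_decomposition_card_le_support [Fintype V] (E : Finset (V × V))
    (hacyc : ∀ v : V, ¬ Relation.TransGen (fun u w => (u, w) ∈ E) v v)
    (f : V × V → ℝ) (hf : ∀ e ∈ E, 0 ≤ f e)
    (a b : V → ℝ) (ha : ∀ v, 0 ≤ a v) (hb : ∀ v, 0 ≤ b v)
    (hdisj : ∀ v, a v = 0 ∨ b v = 0)
    (hcons : Conserves E f a b) :
    ∃ (k : ℕ) (p : Fin k → List V) (w : Fin k → ℝ),
      k ≤ (E.filter (f · ≠ 0)).card + ((univ.filter (a · ≠ 0)).card +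
        (univ.filter (b · ≠ 0)).card) ∧
      (∀ i, IsDiPath E (p i)) ∧
      (∀ i, 0 < w i) ∧
      (∀ e ∈ E, f e = ∑ i, w i * pathIndicator (p i) e) ∧
      (∀ i, ∃ u v : V, (p i).head? = some u ∧ a u ≠ 0 ∧
        (p i).getLast? = some v ∧ b v ≠ 0) ∧
      (∀ v : V, ∑ i ∈ Finset.univ.filter (fun i => (p i).head? = some v), w i = a v) ∧
      (∀ v : V, ∑ i ∈ Finset.univ.filter (fun i => (p i).getLast? = some v), w i = b v) := by
  induction hN : (E.filter (f · ≠ 0)).card + ((univ.filter (a · ≠ 0)).card +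
      (univ.filter (b · ≠ 0)).card) using Nat.strong_induction_on generalizing f a b with
  | _ N ih =>
  by_cases hne : ∃ e ∈ E, f e ≠ 0
  swap
  · push Not at hne
    have hab : ∀ v, a v = b v := by
      intro v
      have h := hcons v
      rw [inflow, outflow, Finset.sum_eq_zero fun e he => hne e (Finset.mem_filter.1 he).1,
        Finset.sum_eq_zero fun e he => hne e (Finset.mem_filter.1 he).1] at h
      simpa using h
    have hb0 : ∀ v, b v = 0 := fun v => (hdisj v).elim (fun h => hab v ▸ h) id
    refine ⟨0, Fin.elim0, Fin.elim0, Nat.zero_le _, fun i => i.elim0, fun i => i.elim0,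
      fun e he => ?_, fun i => i.elim0, fun v => ?_, fun v => ?_⟩
    · simp [hne e he]
    · simp [hab v, hb0 v]
    · simp [hb0 v]
  obtain ⟨x, y, l, z, hchain, hlast, hx, hz⟩ :=
    exists_positive_path E hacyc f hf a b ha hb hcons hne
  set q := x :: y :: l with hq
  have hqE : q.IsChain (fun u w => (u, w) ∈ E) := hchain.imp fun _ _ h => h.1
  have hnodup : q.Nodup := hqE.nodup_of_acyclic hacyc
  have hpath : IsDiPath E q := ⟨hnodup, by simp [hq], hqE⟩
  have hhead : q.head? = some x := rfl
  have hzip : ∀ e ∈ q.zip q.tail, e ∈ E ∧ 0 < f e := fun e he => hchain.of_mem_zip_tail he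
  have hqcons := conserves_pathIndicator E (y :: l) x hnodup hqE
  obtain ⟨c, hc, hmin⟩ := Finset.exists_min_image
    (insert (a x) (insert (b z) ((q.zip q.tail).toFinset.image f))) id ⟨a x, by simp⟩
  simp only [Finset.mem_insert, Finset.mem_image, List.mem_toFinset, id, forall_eq_or_imp,
    forall_exists_index, and_imp, forall_apply_eq_imp_iff₂] at hc hmin
  obtain ⟨hcx, hcz, hce⟩ := hmin
  have hc0 : 0 < c := by
    rcases hc with rfl | rfl | ⟨e, he, rfl⟩
    exacts [hx, hz, (hzip e he).2]
  set f' : V × V → ℝ := fun e => f e - c * pathIndicator q e with hf'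
  set a' : V → ℝ := fun v => a v - c * (if q.head? = some v then 1 else 0) with ha'
  set b' : V → ℝ := fun v => b v - c * (if q.getLast? = some v then 1 else 0) with hb'
  have hf'0 : ∀ e ∈ E, 0 ≤ f' e := by
    intro e he
    by_cases h : e ∈ q.zip q.tail
    · simpa [hf', pathIndicator, h] using hce e h
    · simpa [hf', pathIndicator, h] using hf e he
  have ha'0 : ∀ v, 0 ≤ a' v := by
    intro v
    by_cases h : x = v
    · subst h; simpa [ha', hhead] using hcx
    · simpa [ha', hhead, h] using ha v
  have hb'0 : ∀ v, 0 ≤ b' v := by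
    intro v
    by_cases h : z = v
    · subst h; simpa [hb', hlast] using hcz
    · simpa [hb', hlast, h] using hb v
  have hfs : ∀ e, f' e ≠ 0 → f e ≠ 0 := by
    intro e h h0
    by_cases he : e ∈ q.zip q.tail
    · exact (hzip e he).2.ne' h0
    · exact h (by simp [hf', pathIndicator, he, h0])
  have has : ∀ v, a' v ≠ 0 → a v ≠ 0 := by
    intro v h h0
    by_cases hv : x = v
    · subst hv; exact hx.ne' h0
    · exact h (by simp [ha', hhead, hv, h0])
  have hbs : ∀ v, b' v ≠ 0 → b v ≠ 0 := by
    intro v h h0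
    by_cases hv : z = v
    · subst hv; exact hz.ne' h0
    · exact h (by simp [hb', hlast, hv, h0])
  have hdisj' : ∀ v, a' v = 0 ∨ b' v = 0 := fun v =>
    (hdisj v).imp (fun h => not_not.1 fun h' => has v h' h) (fun h => not_not.1 fun h' => hbs v h' h)
  have hcons' : Conserves E f' a' b' := by
    intro v
    have h₁ := hcons v
    have h₂ := hqcons v
    simp only [hf', ha', hb', inflow_sub_mul, outflow_sub_mul]
    linear_combination h₁ - c * h₂
  have hFs : E.filter (f' · ≠ 0) ⊆ E.filter (f · ≠ 0) :=
    Finset.monotone_filter_right E fun e _ => hfs e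
  have hAs : univ.filter (a' · ≠ 0) ⊆ univ.filter (a · ≠ 0) :=
    Finset.monotone_filter_right _ fun v _ => has v
  have hBs : univ.filter (b' · ≠ 0) ⊆ univ.filter (b · ≠ 0) :=
    Finset.monotone_filter_right _ fun v _ => hbs v
  have hlt : (E.filter (f' · ≠ 0)).card + ((univ.filter (a' · ≠ 0)).card +
      (univ.filter (b' · ≠ 0)).card) < N := by
    have hF := Finset.card_le_card hFs
    have hA := Finset.card_le_card hAs
    have hB := Finset.card_le_card hBs
    rcases hc with rfl | rfl | ⟨e, he, rfl⟩
    · have := Finset.card_lt_card (Finset.ssubset_iff_subset_ne.2 ⟨hAs, fun h => by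
        have : x ∈ univ.filter (a' · ≠ 0) := h ▸ by simp [hx.ne']
        simp [ha', hhead] at this⟩)
      omega
    · have := Finset.card_lt_card (Finset.ssubset_iff_subset_ne.2 ⟨hBs, fun h => by
        have : z ∈ univ.filter (b' · ≠ 0) := h ▸ by simp [hz.ne']
        simp [hb', hlast] at this⟩)
      omega
    · have := Finset.card_lt_card (Finset.ssubset_iff_subset_ne.2 ⟨hFs, fun h => by
        have : e ∈ E.filter (f' · ≠ 0) := h ▸ by simp [(hzip e he).1, (hzip e he).2.ne']
        simp [hf', pathIndicator, he] at this⟩)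
      omega
  obtain ⟨k, p, w, hk, hp, hw, hsum, hends, hstart, hend⟩ :=
    ih _ hlt f' hf'0 a' b' ha'0 hb'0 hdisj' hcons' rfl
  refine ⟨k + 1, Fin.cons q p, Fin.cons c w, by omega, ?_, ?_, ?_, ?_, ?_, ?_⟩
  · exact Fin.cases hpath hp
  · exact Fin.cases hc0 hw
  · intro e he
    rw [Fin.sum_univ_succ]
    simp only [Fin.cons_zero, Fin.cons_succ, ← hsum e he, hf']
    ring
  · refine Fin.cases ⟨x, z, hhead, hx.ne', hlast, hz.ne'⟩ fun i => ?_
    obtain ⟨u, v, hu, hau, hv, hbv⟩ := hends i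
    exact ⟨u, v, hu, has u hau, hv, hbs v hbv⟩
  · intro v
    have h := hstart v
    rw [Finset.sum_filter] at h ⊢
    rw [Fin.sum_univ_succ]
    simp only [Fin.cons_zero, Fin.cons_succ, h, ha', mul_ite, mul_one, mul_zero]
    ring
  · intro v
    have h := hend v
    rw [Finset.sum_filter] at h ⊢
    rw [Fin.sum_univ_succ]
    simp only [Fin.cons_zero, Fin.cons_succ, h, hb', mul_ite, mul_one, mul_zero]
    ring

end Flow

/-- **Flow decomposition on a finite DAG.**
A nonnegative flow conserving an injection `a` and an extraction `b` with disjoint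
supports decomposes into at most `|E| + |V|` weighted directed paths: the flow on each
edge is the total weight of paths through it, each path starts in the support of `a`
and ends in the support of `b`, the total weight of paths starting (resp. ending) at
`v` is `a v` (resp. `b v`). -/
theorem flow_decomposition_dag
    {V : Type*} [Fintype V] [DecidableEq V]
    (E : Finset (V × V))
    (hacyc : ∀ v : V, ¬ Relation.TransGen (fun u w => (u, w) ∈ E) v v)
    (f : V × V → ℝ) (hf : ∀ e ∈ E, 0 ≤ f e)
    (a b : V → ℝ) (ha : ∀ v, 0 ≤ a v) (hb : ∀ v, 0 ≤ b v)
    (hdisj : ∀ v, a v = 0 ∨ b v = 0)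
    (hcons : Conserves E f a b) :
    ∃ (k : ℕ) (p : Fin k → List V) (w : Fin k → ℝ),
      k ≤ E.card + Fintype.card V ∧
      (∀ i, IsDiPath E (p i)) ∧
      (∀ i, 0 < w i) ∧
      (∀ e ∈ E, f e = ∑ i, w i * pathIndicator (p i) e) ∧
      (∀ i, ∃ u v : V, (p i).head? = some u ∧ a u ≠ 0 ∧
        (p i).getLast? = some v ∧ b v ≠ 0) ∧
      (∀ v : V, ∑ i ∈ Finset.univ.filter (fun i => (p i).head? = some v), w i = a v) ∧
      (∀ v : V, ∑ i ∈ Finset.univ.filter (fun i => (p i).getLast? = some v), w i = b v) := by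
  obtain ⟨k, p, w, hk, h⟩ :=
    exists_decomposition_card_le_support E hacyc f hf a b ha hb hdisj hcons
  refine ⟨k, p, w, hk.trans (Nat.add_le_add (Finset.card_filter_le _ _) ?_), h⟩
  rw [← Finset.card_union_of_disjoint]
  · exact Finset.card_le_univ _
  · rw [Finset.disjoint_filter]
    exact fun v _ hav => not_not.2 ((hdisj v).resolve_left hav)
end

section
/- (Equivalency between customer flows and bundled customer flows.) Let (V,E) be a finite directed acyclic graph. Consider M customer requests, where request m ∈ {1, …, M} has a source set S_m ⊆ V, an intensity λ_m ≥ 0, and a per-node injection a_m : V → ℝ≥0 supported on S_m with Σ_{v ∈ V} a_m(v) = λ_m; assume the sets S₁, …, S_M are pairwise disjoint and each is disjoint from a common sink set D ⊆ V. Suppose the bundled customer flow f_B : E → ℝ≥0 conserves (Σ_{m=1}^M a_m, b) for some extraction b : V → ℝ≥0 supported on D with Σ_{v ∈ V} b(v) = Σ_{m=1}^M λ_m. Then for each m ∈ {1, …, M} there exist a nonnegative flow f_m : E → ℝ≥0 and an extraction b_m : V → ℝ≥0 supported on D with Σ_{v ∈ V} b_m(v) = λ_m, such that f_m conserves (a_m,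 b_m), and moreover Σ_{m=1}^M f_m(e) = f_B(e) for every e ∈ E and Σ_{m=1}^M b_m(v) = b(v) for every v ∈ V. -/
open Finset

/-- The edge relation of a finite directed graph without directed cycles is well-founded. -/
theorem wellFounded_of_acyclic {V : Type*} [Finite V] {r : V → V → Prop}
    (h : ∀ v, ¬ Relation.TransGen r v v) : WellFounded r := by
  have : Std.Irrefl (Relation.TransGen r) := ⟨h⟩
  exact Subrelation.wf Relation.TransGen.single
    (Finite.wellFounded_of_trans_of_irrefl (Relation.TransGen r))

/-- The total inflow over all vertices equals the total outflow. -/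
theorem sum_inflow_eq_sum_outflow {V : Type*} [Fintype V] [DecidableEq V]
    (E : Finset (V × V)) (f : V × V → ℝ) :
    ∑ v, inflow E f v = ∑ v, outflow E f v := by
  unfold inflow outflow
  rw [Finset.sum_fiberwise, Finset.sum_fiberwise]

/-- A conserved flow extracts exactly what is injected. -/
theorem Conserves.sum_eq {V : Type*} [Fintype V] [DecidableEq V]
    {E : Finset (V × V)} {f : V × V → ℝ} {a b : V → ℝ} (h : Conserves E f a b) :
    ∑ v, b v = ∑ v, a v := by
  have h₁ := Finset.sum_congr rfl fun v (_ : v ∈ Finset.univ) => h v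
  rw [Finset.sum_add_distrib, Finset.sum_add_distrib, sum_inflow_eq_sum_outflow] at h₁
  exact (add_left_cancel h₁).symm

/-- On an acyclic graph, mixing fractions with prescribed weights `f` on the edges, injection `a`
and normalisation `T` exist. -/
theorem exists_mixing_fraction {V : Type*} [DecidableEq V] (E : Finset (V × V))
    (hwf : WellFounded fun u w => (u, w) ∈ E) (f : V × V → ℝ) (a T : V → ℝ) :
    ∃ p : V → ℝ, ∀ v, p v = (inflow E (fun e => p e.1 * f e) v + a v) / T v := by
  let step (v : V) (rec : ∀ u, (u, v) ∈ E → ℝ) : ℝ :=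
    (∑ e ∈ (E.filter (fun e => e.2 = v)).attach,
      rec e.1.1 (by
        obtain ⟨hE, hv⟩ := Finset.mem_filter.1 e.2
        exact (congrArg (fun w => (e.1.1, w) ∈ E) hv).mp hE) * f e.1 + a v) / T v
  refine ⟨hwf.fix step, fun v => ?_⟩
  rw [hwf.fix_eq]
  simp only [step, inflow]
  rw [← Finset.sum_attach (E.filter (fun e => e.2 = v))]

/-- **Equivalency between customer flows and bundled customer flows.**
On a finite DAG, a nonnegative bundled flow `fB` conserving the aggregate injection
`Σ_m a_m` (with pairwise disjoint source supports, all disjoint from the sink set `D`)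
and an extraction `b` supported on `D`, splits into per-request nonnegative flows
`f m` conserving `(a m, bm m)`, with the `bm m` supported on `D`, of total mass `λ_m`,
summing to `b`, and with `Σ_m f m = fB` edgewise. -/
theorem bundled_flow_decomposition
    {V : Type*} [Fintype V] [DecidableEq V]
    (E : Finset (V × V))
    (hacyc : ∀ v : V, ¬ Relation.TransGen (fun u w => (u, w) ∈ E) v v)
    (M : ℕ) (S : Fin M → Finset V) (lam : Fin M → ℝ) (hlam : ∀ m, 0 ≤ lam m)
    (a : Fin M → V → ℝ) (ha : ∀ m v, 0 ≤ a m v)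
    (haSupp : ∀ m v, a m v ≠ 0 → v ∈ S m)
    (haSum : ∀ m, ∑ v : V, a m v = lam m)
    (D : Finset V)
    (hSdisj : ∀ m m' : Fin M, m ≠ m' → Disjoint (S m) (S m'))
    (hSD : ∀ m, Disjoint (S m) D)
    (fB : V × V → ℝ) (hfB : ∀ e ∈ E, 0 ≤ fB e)
    (b : V → ℝ) (hb : ∀ v, 0 ≤ b v) (hbSupp : ∀ v, b v ≠ 0 → v ∈ D)
    (hbSum : ∑ v : V, b v = ∑ m : Fin M, lam m)
    (hcons : Conserves E fB (fun v => ∑ m : Fin M, a m v) b) :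
    ∃ (f : Fin M → V × V → ℝ) (bm : Fin M → V → ℝ),
      (∀ m, ∀ e ∈ E, 0 ≤ f m e) ∧
      (∀ m v, 0 ≤ bm m v) ∧
      (∀ m v, bm m v ≠ 0 → v ∈ D) ∧
      (∀ m, ∑ v : V, bm m v = lam m) ∧
      (∀ m, Conserves E (f m) (a m) (bm m)) ∧
      (∀ e ∈ E, ∑ m : Fin M, f m e = fB e) ∧
      (∀ v : V, ∑ m : Fin M, bm m v = b v) := by
  have hwf := wellFounded_of_acyclic hacyc
  let T : V → ℝ := fun v => inflow E fB v + ∑ m, a m v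
  have hT_out (v : V) : T v = outflow E fB v + b v := hcons v
  have h_in (v : V) : 0 ≤ inflow E fB v :=
    Finset.sum_nonneg fun e he => hfB e (Finset.mem_filter.1 he).1
  have h_out (v : V) : 0 ≤ outflow E fB v :=
    Finset.sum_nonneg fun e he => hfB e (Finset.mem_filter.1 he).1
  have h_inj (v : V) : 0 ≤ ∑ m, a m v := Finset.sum_nonneg fun m _ => ha m v
  have hT (v : V) : 0 ≤ T v := add_nonneg (h_in v) (h_inj v)
  have hT_zero_in (e : V × V) (he : e ∈ E) (h : T e.2 = 0) : fB e = 0 := by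
    have h₀ : inflow E fB e.2 = 0 := by linarith [h_in e.2, h_inj e.2, show T e.2 = _ from rfl]
    exact (Finset.sum_eq_zero_iff_of_nonneg
      fun e he => hfB e (Finset.mem_filter.1 he).1).1 h₀ e (Finset.mem_filter.2 ⟨he, rfl⟩)
  have hT_zero_out (e : V × V) (he : e ∈ E) (h : T e.1 = 0) : fB e = 0 := by
    have h₀ : outflow E fB e.1 = 0 := by linarith [h_out e.1, hb e.1, hT_out e.1]
    exact (Finset.sum_eq_zero_iff_of_nonneg
      fun e he => hfB e (Finset.mem_filter.1 he).1).1 h₀ e (Finset.mem_filter.2 ⟨he, rfl⟩)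
  have hT_zero_inj (m : Fin M) (v : V) (h : T v = 0) : a m v = 0 := by
    have h₀ : ∑ m, a m v = 0 := by linarith [h_in v, h_inj v, show T v = _ from rfl]
    exact (Finset.sum_eq_zero_iff_of_nonneg fun m _ => ha m v).1 h₀ m (Finset.mem_univ m)
  choose p hp using fun m => exists_mixing_fraction E hwf fB (a m) T
  have hp_nonneg (m : Fin M) (v : V) : 0 ≤ p m v := by
    induction v using hwf.induction with
    | _ v ih =>
      rw [hp]
      refine div_nonneg (add_nonneg (Finset.sum_nonneg fun e he => ?_) (ha m v)) (hT v)
      obtain ⟨hE, rfl⟩ := Finset.mem_filter.1 he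
      exact mul_nonneg (ih e.1 hE) (hfB e hE)
  have hp_mul (m : Fin M) (v : V) :
      p m v * T v = inflow E (fun e => p m e.1 * fB e) v + a m v := by
    by_cases h : T v = 0
    · rw [h, mul_zero, hT_zero_inj m v h, add_zero, inflow, Finset.sum_eq_zero]
      intro e he
      obtain ⟨hE, rfl⟩ := Finset.mem_filter.1 he
      rw [hT_zero_in e hE h, mul_zero]
    · conv_lhs => rw [hp]
      exact div_mul_cancel₀ _ h
  have hp_edge (e : V × V) (he : e ∈ E) (h : (∑ m, p m e.1) * T e.1 = T e.1) :
      ∑ m, p m e.1 * fB e = fB e := by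
    rw [← Finset.sum_mul]
    by_cases h₀ : T e.1 = 0
    · rw [hT_zero_out e he h₀, mul_zero]
    · rw [(mul_eq_right₀ h₀).1 h, one_mul]
  have hp_sum (v : V) : (∑ m, p m v) * T v = T v := by
    induction v using hwf.induction with
    | _ v ih =>
      simp only [Finset.sum_mul, hp_mul, Finset.sum_add_distrib]
      simp only [T, inflow]
      rw [Finset.sum_comm]
      congr 1
      refine Finset.sum_congr rfl fun e he => ?_
      obtain ⟨hE, rfl⟩ := Finset.mem_filter.1 he
      exact hp_edge e hE (ih e.1 hE)
  have hp_cons (m : Fin M) :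
      Conserves E (fun e => p m e.1 * fB e) (a m) (fun v => p m v * b v) := by
    intro v
    rw [← hp_mul, hT_out, mul_add, outflow, outflow, Finset.mul_sum]
    congr 1
    refine Finset.sum_congr rfl fun e he => ?_
    rw [(Finset.mem_filter.1 he).2]
  refine ⟨fun m e => p m e.1 * fB e, fun m v => p m v * b v,
    fun m e he => mul_nonneg (hp_nonneg m e.1) (hfB e he),
    fun m v => mul_nonneg (hp_nonneg m v) (hb v),
    fun m v h => hbSupp v (right_ne_zero_of_mul h),
    fun m => (hp_cons m).sum_eq.trans (haSum m), hp_cons,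
    fun e he => hp_edge e he (hp_sum e.1), fun v => ?_⟩
  rw [← Finset.sum_mul]
  by_cases h₀ : T v = 0
  · have : b v = 0 := by linarith [h_out v, hb v, hT_out v]
    rw [this, mul_zero]
  · rw [(mul_eq_right₀ h₀).1 (hp_sum v), one_mul]
end

section
/- (The socially optimal solution of the joint problem is a general equilibrium under locational marginal pricing.) Suppose the joint LP has an optimal solution. Then there exist multiplier vectors λ* ∈ ℝ^{k₅} and μ* ∈ ℝ^{k₆} with μ* ≥ 0 (componentwise) such that for EVERY optimal solution (x*, y*) of the joint LP: (i) complementary slackness holds, i.e., μ*ᵀ(P x* + Q y* − q) = 0; (ii) x* is an optimal solution of the transportation operator's LP: minimize c₁ᵀx + λ*ᵀ(E x) + μ*ᵀ(P x) over x ∈ X; (iii) y* is an optimal solution of the generators' LP: minimize c₂ᵀy + λ*ᵀ(F y) + μ*ᵀ(Q y) over y ∈ Y. In particular, at the prices given by the coupling multipliers (the locational marginal prices λ* + μ*), neither the self-interested transportation operator nor the self-interested generators have an incentive to deviate from the socially optimal solution. -/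
open Matrix

/-- Transportation-operator feasible set: `X = {x : A x = a, G x ≤ g}`. -/
def memX {n k1 k2 : ℕ} (A : Matrix (Fin k1) (Fin n) ℝ) (a : Fin k1 → ℝ)
    (G : Matrix (Fin k2) (Fin n) ℝ) (g : Fin k2 → ℝ) (x : Fin n → ℝ) : Prop :=
  A.mulVec x = a ∧ G.mulVec x ≤ g

/-- Power-side feasible set: `Y = {y : B y = b, H y ≤ h}`. -/
def memY {p k3 k4 : ℕ} (B : Matrix (Fin k3) (Fin p) ℝ) (b : Fin k3 → ℝ)
    (H : Matrix (Fin k4) (Fin p) ℝ) (h : Fin k4 → ℝ) (y : Fin p → ℝ) : Prop :=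
  B.mulVec y = b ∧ H.mulVec y ≤ h

/-- **Farkas' lemma** for finitely many linear functionals. -/
theorem exists_nonneg_sum_smul_eq_of_nonneg {V ι : Type*} [AddCommGroup V] [Module ℝ V]
    (s : Finset ι) (φ : ι → V →ₗ[ℝ] ℝ) (ψ : V →ₗ[ℝ] ℝ)
    (hψ : ∀ x, (∀ i ∈ s, 0 ≤ φ i x) → 0 ≤ ψ x) :
    ∃ w : ι → ℝ, 0 ≤ w ∧ ∀ x, ψ x = ∑ i ∈ s, w i * φ i x := by
  classical
  induction s using Finset.induction_on generalizing φ ψ with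
  | empty =>
    refine ⟨0, le_rfl, fun x => ?_⟩
    have h₁ := hψ x (by simp)
    have h₂ := hψ (-x) (by simp)
    rw [map_neg] at h₂
    simp only [Finset.sum_empty]
    linarith
  | insert j s hj ih =>
    by_cases hs : ∀ x, (∀ i ∈ s, 0 ≤ φ i x) → 0 ≤ ψ x
    · obtain ⟨w, hw, hsum⟩ := ih φ ψ hs
      refine ⟨Function.update w j 0, ?_, fun x => ?_⟩
      · intro i
        by_cases hij : i = j
        · simp [hij]
        · simpa [hij] using hw i
      · rw [Finset.sum_insert hj, hsum x, Function.update_self, zero_mul, zero_add]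
        refine Finset.sum_congr rfl fun i hi => ?_
        rw [Function.update_of_ne (ne_of_mem_of_not_mem hi hj)]
    · push Not at hs
      obtain ⟨x₁, hx₁, hψx₁⟩ := hs
      have hφx₁ : φ j x₁ < 0 := by
        by_contra! hle
        exact hψx₁.not_ge (hψ x₁ (Finset.forall_mem_insert _ _ _ |>.2 ⟨hle, hx₁⟩))
      obtain ⟨x₀, hx₀, hψx₀, hφx₀⟩ :
          ∃ x₀, (∀ i ∈ s, 0 ≤ φ i x₀) ∧ ψ x₀ < 0 ∧ φ j x₀ = -1 := by
        have hpos : 0 < (-φ j x₁)⁻¹ := inv_pos.2 (neg_pos.2 hφx₁)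
        refine ⟨(-φ j x₁)⁻¹ • x₁, fun i hi => ?_, ?_, ?_⟩
        · simpa only [map_smul, smul_eq_mul] using mul_nonneg hpos.le (hx₁ i hi)
        · simpa only [map_smul, smul_eq_mul] using mul_neg_of_pos_of_neg hpos hψx₁
        · rw [map_smul, smul_eq_mul]
          field_simp [hφx₁.ne]
      obtain ⟨w, hw, hsum⟩ := ih (fun i => φ i + φ i x₀ • φ j) (ψ + ψ x₀ • φ j) (by
        intro x hx
        have := hψ (x + φ j x • x₀) (by
          intro i hi
          obtain rfl | hi := Finset.mem_insert.1 hi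
          · simp [hφx₀]
          · simpa [mul_comm] using hx i hi)
        simpa [mul_comm] using this)
      have hcoef : 0 ≤ ∑ i ∈ s, w i * φ i x₀ - ψ x₀ := by
        have := Finset.sum_nonneg fun i hi => mul_nonneg (hw i) (hx₀ i hi)
        linarith
      refine ⟨Function.update w j (∑ i ∈ s, w i * φ i x₀ - ψ x₀), ?_, fun x => ?_⟩
      · intro i
        by_cases hij : i = j
        · subst hij; simpa using hcoef
        · simpa [hij] using hw i
      · rw [Finset.sum_insert hj, Function.update_self]
        have hcongr : ∑ i ∈ s, Function.update w j (∑ i ∈ s, w i * φ i x₀ - ψ x₀) i * φ i x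
            = ∑ i ∈ s, w i * φ i x :=
          Finset.sum_congr rfl fun i hi => by
            rw [Function.update_of_ne (ne_of_mem_of_not_mem hi hj)]
        have := hsum x
        simp only [LinearMap.add_apply, LinearMap.smul_apply, smul_eq_mul, mul_add,
          Finset.sum_add_distrib, ← mul_assoc, ← Finset.sum_mul] at this
        rw [hcongr]
        linarith

/-- A lower bound for a linear functional on a nonempty polyhedron is certified by
nonnegative multipliers. -/
theorem exists_nonneg_multipliers {V ι : Type*} [AddCommGroup V] [Module ℝ V] [Fintype ι]
    (φ : ι → V →ₗ[ℝ] ℝ) (r : ι → ℝ) (ψ : V →ₗ[ℝ] ℝ) (v : ℝ)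
    (hne : ∃ z, ∀ i, φ i z ≤ r i) (hv : ∀ z, (∀ i, φ i z ≤ r i) → v ≤ ψ z) :
    ∃ w : ι → ℝ, 0 ≤ w ∧ ∀ z, v ≤ ψ z + ∑ i, w i * (φ i z - r i) := by
  obtain ⟨z₀, hz₀⟩ := hne
  let Φ : Option ι → V × ℝ →ₗ[ℝ] ℝ := fun o => o.elim (LinearMap.snd ℝ V ℝ)
    fun i => r i • LinearMap.snd ℝ V ℝ - φ i ∘ₗ LinearMap.fst ℝ V ℝ
  obtain ⟨w, hw, hsum⟩ := exists_nonneg_sum_smul_eq_of_nonneg Finset.univ Φ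
    (ψ ∘ₗ LinearMap.fst ℝ V ℝ - v • LinearMap.snd ℝ V ℝ) (by
      rintro ⟨z, t⟩ hzt
      have ht : 0 ≤ t := hzt none (Finset.mem_univ _)
      have hz : ∀ i, φ i z ≤ r i * t := fun i => by
        simpa [Φ] using hzt (some i) (Finset.mem_univ _)
      suffices v * t ≤ ψ z by simpa
      obtain rfl | ht := ht.eq_or_lt
      · rw [mul_zero]
        by_contra! hlt
        -- `z` is a recession direction along which `ψ` is unbounded below.
        have h₀ := hv z₀ hz₀
        have hc : 0 ≤ (ψ z₀ - v + 1) / -ψ z :=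
          div_nonneg (by linarith) (by linarith)
        have := hv (z₀ + ((ψ z₀ - v + 1) / -ψ z) • z) fun i => by
          have h₁ := mul_nonpos_of_nonneg_of_nonpos hc ((hz i).trans_eq (mul_zero _))
          have h₂ := hz₀ i
          rw [map_add, map_smul, smul_eq_mul]
          linarith
        rw [map_add, map_smul, smul_eq_mul, div_mul_eq_mul_div, div_neg,
          mul_div_cancel_right₀ _ hlt.ne] at this
        linarith
      · have := hv (t⁻¹ • z) fun i => by
          rw [map_smul, smul_eq_mul, inv_mul_le_iff₀ ht, mul_comm]
          exact hz i
        rwa [map_smul, smul_eq_mul, le_inv_mul_iff₀ ht, mul_comm] at this)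
  refine ⟨fun i => w (some i), fun i => hw _, fun z => ?_⟩
  have h₁ := hsum (z, 1)
  have h₀ : 0 ≤ w none := hw none
  have h₂ : ∑ i, w (some i) * (φ i z - r i) = -∑ i, w (some i) * (r i - φ i z) := by
    rw [← Finset.sum_neg_distrib]
    exact Finset.sum_congr rfl fun i _ => by ring
  simp [Fintype.sum_option, Φ] at h₁
  linarith

/-- Lagrange multipliers for a linear program with equality and inequality constraints. -/
theorem exists_lagrange_multipliers {V ι κ : Type*} [AddCommGroup V] [Module ℝ V]
    [Fintype ι] [Fintype κ] (φ : ι → V →ₗ[ℝ] ℝ) (r : ι → ℝ) (χ : κ → V →ₗ[ℝ] ℝ) (s : κ → ℝ)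
    (ψ : V →ₗ[ℝ] ℝ) (v : ℝ) (hne : ∃ z, (∀ i, φ i z ≤ r i) ∧ ∀ k, χ k z = s k)
    (hv : ∀ z, (∀ i, φ i z ≤ r i) → (∀ k, χ k z = s k) → v ≤ ψ z) :
    ∃ (μ : ι → ℝ) (l : κ → ℝ), 0 ≤ μ ∧
      ∀ z, v ≤ ψ z + ∑ i, μ i * (φ i z - r i) + ∑ k, l k * (χ k z - s k) := by
  obtain ⟨z₀, hz₀, hz₀'⟩ := hne
  obtain ⟨w, hw, hbound⟩ := exists_nonneg_multipliers
    (Sum.elim φ (Sum.elim χ fun k => -χ k)) (Sum.elim r (Sum.elim s fun k => -s k)) ψ v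
    ⟨z₀, by simp [hz₀, hz₀']⟩ (by
      intro z hz
      simp only [Sum.forall, Sum.elim_inl, Sum.elim_inr, LinearMap.neg_apply, neg_le_neg_iff] at hz
      exact hv z hz.1 fun k => le_antisymm (hz.2.1 k) (hz.2.2 k))
  refine ⟨fun i => w (.inl i), fun k => w (.inr (.inl k)) - w (.inr (.inr k)),
    fun i => hw _, fun z => (hbound z).trans_eq ?_⟩
  simp only [Fintype.sum_sum_type, Sum.elim_inl, Sum.elim_inr, LinearMap.neg_apply]
  rw [← Finset.sum_add_distrib, add_assoc]
  congr 2
  exact Finset.sum_congr rfl fun k _ => by ring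

/-- **The socially optimal solution of the joint P-AMoD LP is a general equilibrium
under locational marginal pricing.**  If the joint LP
`min c₁ᵀx + c₂ᵀy  s.t. x ∈ X, y ∈ Y, Ex + Fy = e, Px + Qy ≤ q`
has an optimal solution, then there are multipliers `λ*` and `μ* ≥ 0` such that every
optimal solution `(x*, y*)` satisfies complementary slackness, `x*` solves the
transportation operator's priced LP over `X`, and `y*` solves the generators' priced
LP over `Y`. -/
theorem socially_optimal_is_general_equilibrium
    {n p k1 k2 k3 k4 k5 k6 : ℕ}
    (c1 : Fin n → ℝ) (c2 : Fin p → ℝ)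
    (A : Matrix (Fin k1) (Fin n) ℝ) (a : Fin k1 → ℝ)
    (G : Matrix (Fin k2) (Fin n) ℝ) (g : Fin k2 → ℝ)
    (B : Matrix (Fin k3) (Fin p) ℝ) (b : Fin k3 → ℝ)
    (H : Matrix (Fin k4) (Fin p) ℝ) (h : Fin k4 → ℝ)
    (E : Matrix (Fin k5) (Fin n) ℝ) (F : Matrix (Fin k5) (Fin p) ℝ) (e : Fin k5 → ℝ)
    (P : Matrix (Fin k6) (Fin n) ℝ) (Q : Matrix (Fin k6) (Fin p) ℝ) (q : Fin k6 → ℝ)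
    (hopt : ∃ x y, memX A a G g x ∧ memY B b H h y ∧
      E.mulVec x + F.mulVec y = e ∧ P.mulVec x + Q.mulVec y ≤ q ∧
      ∀ x' y', memX A a G g x' → memY B b H h y' →
        E.mulVec x' + F.mulVec y' = e → P.mulVec x' + Q.mulVec y' ≤ q →
        c1 ⬝ᵥ x + c2 ⬝ᵥ y ≤ c1 ⬝ᵥ x' + c2 ⬝ᵥ y') :
    ∃ (lam : Fin k5 → ℝ) (mu : Fin k6 → ℝ), 0 ≤ mu ∧
      ∀ xs ys,
        (memX A a G g xs ∧ memY B b H h ys ∧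
          E.mulVec xs + F.mulVec ys = e ∧ P.mulVec xs + Q.mulVec ys ≤ q ∧
          ∀ x' y', memX A a G g x' → memY B b H h y' →
            E.mulVec x' + F.mulVec y' = e → P.mulVec x' + Q.mulVec y' ≤ q →
            c1 ⬝ᵥ xs + c2 ⬝ᵥ ys ≤ c1 ⬝ᵥ x' + c2 ⬝ᵥ y') →
        -- (i) complementary slackness
        (mu ⬝ᵥ (P.mulVec xs + Q.mulVec ys - q) = 0) ∧
        -- (ii) x* is optimal for the transportation operator's priced LP over X
        (∀ x', memX A a G g x' →
          c1 ⬝ᵥ xs + lam ⬝ᵥ (E.mulVec xs) + mu ⬝ᵥ (P.mulVec xs) ≤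
            c1 ⬝ᵥ x' + lam ⬝ᵥ (E.mulVec x') + mu ⬝ᵥ (P.mulVec x')) ∧
        -- (iii) y* is optimal for the generators' priced LP over Y
        (∀ y', memY B b H h y' →
          c2 ⬝ᵥ ys + lam ⬝ᵥ (F.mulVec ys) + mu ⬝ᵥ (Q.mulVec ys) ≤
            c2 ⬝ᵥ y' + lam ⬝ᵥ (F.mulVec y') + mu ⬝ᵥ (Q.mulVec y')) := by
  obtain ⟨x₀, y₀, ⟨hA, hG⟩, ⟨hB, hH⟩, hE, hP, hmin⟩ := hopt
  let row {k : ℕ} (M : Matrix (Fin k) (Fin n) ℝ) (N : Matrix (Fin k) (Fin p) ℝ) (i : Fin k) :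
      (Fin n → ℝ) × (Fin p → ℝ) →ₗ[ℝ] ℝ :=
    LinearMap.proj i ∘ₗ M.mulVecLin.coprod N.mulVecLin
  have row_apply {k : ℕ} (M : Matrix (Fin k) (Fin n) ℝ) (N : Matrix (Fin k) (Fin p) ℝ)
      (i : Fin k) (x : Fin n → ℝ) (y : Fin p → ℝ) :
      row M N i (x, y) = (M.mulVec x + N.mulVec y) i := by simp [row]
  obtain ⟨μ, l, hμ, hbound⟩ := exists_lagrange_multipliers
    (Sum.elim (row G 0) (Sum.elim (row 0 H) (row P Q))) (Sum.elim g (Sum.elim h q))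
    (Sum.elim (row A 0) (Sum.elim (row 0 B) (row E F))) (Sum.elim a (Sum.elim b e))
    ((dotProductBilin ℝ ℝ c1).coprod (dotProductBilin ℝ ℝ c2)) (c1 ⬝ᵥ x₀ + c2 ⬝ᵥ y₀)
    ⟨(x₀, y₀), by
      simp only [Sum.forall, Sum.elim_inl, Sum.elim_inr, row_apply, zero_mulVec, add_zero,
        zero_add]
      exact ⟨⟨hG, hH, hP⟩, congrFun hA, congrFun hB, congrFun hE⟩⟩ (by
      rintro ⟨x, y⟩ hle heq
      simp only [Sum.forall, Sum.elim_inl, Sum.elim_inr, row_apply, zero_mulVec, add_zero,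
        zero_add] at hle heq
      exact hmin x y ⟨funext heq.1, hle.1⟩ ⟨funext heq.2.1, hle.2.1⟩ (funext heq.2.2) hle.2.2)
  set lam : Fin k5 → ℝ := fun i => l (.inr (.inr i))
  set mu : Fin k6 → ℝ := fun i => μ (.inr (.inr i))
  have hmu : 0 ≤ mu := fun i => hμ _
  have hlag : ∀ x y, memX A a G g x → memY B b H h y → c1 ⬝ᵥ x₀ + c2 ⬝ᵥ y₀ ≤
      c1 ⬝ᵥ x + c2 ⬝ᵥ y + mu ⬝ᵥ (P.mulVec x + Q.mulVec y - q) +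
        lam ⬝ᵥ (E.mulVec x + F.mulVec y - e) := by
    rintro x y ⟨hAx, hGx⟩ ⟨hBy, hHy⟩
    have := hbound (x, y)
    simp only [Fintype.sum_sum_type, Sum.elim_inl, Sum.elim_inr, row_apply, zero_mulVec,
      add_zero, zero_add, hAx, hBy, sub_self, mul_zero, Finset.sum_const_zero] at this
    have h₁ : ∑ i, μ (.inl i) * (G.mulVec x i - g i) ≤ 0 := Finset.sum_nonpos fun i _ =>
      mul_nonpos_of_nonneg_of_nonpos (hμ _) (sub_nonpos.2 (hGx i))
    have h₂ : ∑ i, μ (.inr (.inl i)) * (H.mulVec y i - h i) ≤ 0 := Finset.sum_nonpos fun i _ =>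
      mul_nonpos_of_nonneg_of_nonpos (hμ _) (sub_nonpos.2 (hHy i))
    change _ ≤ c1 ⬝ᵥ x + c2 ⬝ᵥ y + (_ + (_ + mu ⬝ᵥ (P.mulVec x + Q.mulVec y - q))) +
      lam ⬝ᵥ (E.mulVec x + F.mulVec y - e) at this
    linarith
  refine ⟨lam, mu, hmu, ?_⟩
  rintro xs ys ⟨hX, hY, hEs, hPs, hmins⟩
  have hval := hmins x₀ y₀ ⟨hA, hG⟩ ⟨hB, hH⟩ hE hP
  have hcs : mu ⬝ᵥ (P.mulVec xs + Q.mulVec ys - q) = 0 := by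
    have hle : mu ⬝ᵥ (P.mulVec xs + Q.mulVec ys - q) ≤ 0 := Finset.sum_nonpos fun i _ =>
      mul_nonpos_of_nonneg_of_nonpos (hmu i) (sub_nonpos.2 (hPs i))
    have := hlag xs ys hX hY
    rw [hEs, sub_self, dotProduct_zero] at this
    linarith
  have hlams : lam ⬝ᵥ (E.mulVec xs + F.mulVec ys - e) = 0 := by
    rw [hEs, sub_self, dotProduct_zero]
  refine ⟨hcs, fun x' hx' => ?_, fun y' hy' => ?_⟩
  · have := hlag x' ys hx' hY
    simp only [dotProduct_sub, dotProduct_add] at this hcs hlams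
    linarith
  · have := hlag xs y' hX hy'
    simp only [dotProduct_sub, dotProduct_add] at this hcs hlams
    linarith
end
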